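/- Let K ⊂ ℝⁿ be a connected compact body (a nonempty compact set equal to the closure of its interior) of Lebesgue measure one, and let f_K(x) = ∫_K d₁(x,y) dy. Let (P_k)_{k≥1} be a sequence of independent random variables, each uniformly distributed on K, let X_0 ∈ K, and define recursively X_{k+1} = X_k − t_{k+1} Q_{k+1}, where Q_{k+1} = (sgn(X_k¹ − P_{k+1}¹), …, sgn(X_kⁿ − P_{k+1}ⁿ)) and (t_k) is a decreasing sequence of positive reals with ∑_{k=1}^∞ t_k = ∞ and ∑_{k=1}^∞ t_k² < ∞. Then f_K has a unique global minimizer x* and the sequence X_k converges almost surely to x*. -/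

import Mathlib

open MeasureTheory ProbabilityTheory Filter
open scoped ENNReal

/-! ### The sign function -/

lemma Real.sign_monotone : Monotone Real.sign := by
  intro a b hab
  unfold Real.sign
  split_ifs <;> linarith

lemma Real.measurable_sign : Measurable Real.sign := Real.sign_monotone.measurable

lemma Real.norm_sign_le_one (r : ℝ) : ‖Real.sign r‖ ≤ 1 := by
  rcases Real.sign_apply_eq r with h | h | h <;> simp [h]

lemma Real.neg_one_le_sign (r : ℝ) : -1 ≤ Real.sign r := by
  rcases Real.sign_apply_eq r with h | h | h <;> norm_num [h]

lemma Real.continuousAt_sign {r : ℝ} (hr : r ≠ 0) : ContinuousAt Real.sign r := by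
  rcases lt_or_gt_of_ne hr with h | h
  · refine continuousAt_const.congr (f := fun _ => (-1 : ℝ)) ?_
    filter_upwards [eventually_lt_nhds h] with x hx using (Real.sign_of_neg hx).symm
  · refine continuousAt_const.congr (f := fun _ => (1 : ℝ)) ?_
    filter_upwards [eventually_gt_nhds h] with x hx using (Real.sign_of_pos hx).symm

/-- The sign is a subgradient of the absolute value. -/
lemma Real.abs_add_sign_mul_le (c x y : ℝ) :
    |c - y| + Real.sign (c - y) * (x - c) ≤ |x - y| := by
  rcases lt_trichotomy (c - y) 0 with h | h | h
  · rw [Real.sign_of_neg h, abs_of_neg h]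
    linarith [neg_abs_le (x - y)]
  · simp [h]
  · rw [Real.sign_of_pos h, abs_of_pos h]
    linarith [le_abs_self (x - y)]

/-! ### Orbits of the sign recursion in dimension one -/

section Orbit

variable {t p x : ℕ → ℝ}

lemma eventually_lt_of_sign_recursion (ht_pos : ∀ k, 0 < t k) (ht_zero : Tendsto t atTop (nhds 0))
    (ht_div : Tendsto (fun N => ∑ k ∈ Finset.range N, t k) atTop atTop)
    (hx : ∀ k, x (k + 1) = x k - t k * Real.sign (x k - p k)) {q c ε : ℝ} (hc : 0 < c)
    (hS : CauchySeq fun N => ∑ k ∈ Finset.range N, t k * (Real.sign (q - p k) - c))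
    (hε : 0 < ε) : ∀ᶠ k in atTop, x k < q + ε := by
  set S : ℕ → ℝ := fun N => ∑ k ∈ Finset.range N, t k * (Real.sign (q - p k) - c) with hSdef
  have hSsucc : ∀ k, S (k + 1) = S k + t k * (Real.sign (q - p k) - c) := fun k => by
    simp [hSdef, Finset.sum_range_succ]
  obtain ⟨N₁, hN₁⟩ := Metric.cauchySeq_iff.1 hS (ε / 2) (half_pos hε)
  obtain ⟨N₂, hN₂⟩ := eventually_atTop.1 (ht_zero.eventually_lt_const (half_pos hε))
  set N := max N₁ N₂
  have hstep : ∀ k, q ≤ x k → x (k + 1) + S (k + 1) ≤ x k + S k - c * t k := fun k hk => by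
    have := mul_le_mul_of_nonneg_left
      (Real.sign_monotone (sub_le_sub_right hk (p k))) (ht_pos k).le
    rw [hx, hSsucc]
    linarith
  have hhit : ∃ k, N ≤ k ∧ x k < q := by
    by_contra! hcon
    have hbound : ∀ k, N ≤ k → x k + S k ≤
        x N + S N - c * (∑ j ∈ Finset.range k, t j - ∑ j ∈ Finset.range N, t j) := by
      intro k hk
      induction k, hk using Nat.le_induction with
      | base => simp
      | succ k hk ih =>
        rw [Finset.sum_range_succ]
        linarith [hstep k (hcon k hk)]
    obtain ⟨M, hM⟩ := eventually_atTop.1 (ht_div.eventually_ge_atTop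
      (∑ j ∈ Finset.range N, t j + (x N - q + ε / 2) / c))
    have hk := le_max_left N M
    have h1 := hbound _ hk
    have h2 := hM _ (le_max_right N M)
    have h3 := hcon _ hk
    have h4 := hN₁ _ ((le_max_left N₁ N₂).trans hk) N (le_max_left _ _)
    rw [Real.dist_eq, abs_lt] at h4
    have h5 : x N - q + ε / 2 ≤
        c * (∑ j ∈ Finset.range (max N M), t j - ∑ j ∈ Finset.range N, t j) := by
      rw [← div_le_iff₀' hc]
      linarith
    linarith [h4.1]
  obtain ⟨k₀, hk₀, hxk₀⟩ := hhit
  filter_upwards [eventually_ge_atTop k₀] with k hk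
  have hinv : ∃ j, N ≤ j ∧ x k + S k ≤ q + ε / 2 + S j := by
    induction k, hk using Nat.le_induction with
    | base => exact ⟨k₀, hk₀, by linarith⟩
    | succ k hk ih =>
      rcases le_or_gt q (x k) with h | h
      · obtain ⟨j, hj, hle⟩ := ih
        exact ⟨j, hj, by linarith [hstep k h, mul_pos hc (ht_pos k)]⟩
      · refine ⟨k + 1, by lia, ?_⟩
        have h1 := hN₂ k ((le_max_right N₁ N₂).trans (hk₀.trans hk))
        have h2 := mul_le_mul_of_nonneg_left (Real.neg_one_le_sign (x k - p k)) (ht_pos k).le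
        rw [hx]
        linarith
  obtain ⟨j, hj, hle⟩ := hinv
  have h := hN₁ j ((le_max_left _ _).trans hj) k ((le_max_left _ _).trans (hk₀.trans hk))
  rw [Real.dist_eq, abs_lt] at h
  linarith [h.2]

lemma eventually_gt_of_sign_recursion (ht_pos : ∀ k, 0 < t k) (ht_zero : Tendsto t atTop (nhds 0))
    (ht_div : Tendsto (fun N => ∑ k ∈ Finset.range N, t k) atTop atTop)
    (hx : ∀ k, x (k + 1) = x k - t k * Real.sign (x k - p k)) {q c ε : ℝ} (hc : c < 0)
    (hS : CauchySeq fun N => ∑ k ∈ Finset.range N, t k * (Real.sign (q - p k) - c))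
    (hε : 0 < ε) : ∀ᶠ k in atTop, q - ε < x k := by
  have hsign : ∀ a b : ℝ, Real.sign (-a - -b) = -Real.sign (a - b) := fun a b => by
    rw [← Real.sign_neg]
    congr 1
    ring
  have h := eventually_lt_of_sign_recursion (x := fun k => -x k) (p := fun k => -p k) (q := -q)
    ht_pos ht_zero ht_div (fun k => by rw [hx, hsign]; ring) (neg_pos.2 hc) ?_ hε
  · filter_upwards [h] with k hk
    linarith
  · convert uniformContinuous_neg.comp_cauchySeq hS using 2 with N
    simp only [Function.comp, ← Finset.sum_neg_distrib]
    exact Finset.sum_congr rfl fun k _ => by rw [hsign]; ring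

/-- If the weighted signs seen from points arbitrarily close to `m` on either side have
asymptotically the drift `g`, then every orbit of the recursion converges to `m`. -/
lemma tendsto_of_sign_recursion (ht_pos : ∀ k, 0 < t k) (ht_zero : Tendsto t atTop (nhds 0))
    (ht_div : Tendsto (fun N => ∑ k ∈ Finset.range N, t k) atTop atTop)
    (hx : ∀ k, x (k + 1) = x k - t k * Real.sign (x k - p k)) {m : ℝ} {g : ℝ → ℝ} {u : ℕ → ℝ}
    (hu_pos : ∀ l, 0 < u l) (hu : Tendsto u atTop (nhds 0))
    (hpos : ∀ q, m < q → 0 < g q) (hneg : ∀ q, q < m → g q < 0)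
    (hright : ∀ l, CauchySeq fun N =>
      ∑ k ∈ Finset.range N, t k * (Real.sign (m + u l - p k) - g (m + u l)))
    (hleft : ∀ l, CauchySeq fun N =>
      ∑ k ∈ Finset.range N, t k * (Real.sign (m - u l - p k) - g (m - u l))) :
    Tendsto x atTop (nhds m) := by
  rw [tendsto_order]
  constructor <;> intro a ha
  · obtain ⟨l, hl⟩ := (hu.eventually_lt_const (half_pos (sub_pos.2 ha))).exists
    filter_upwards [eventually_gt_of_sign_recursion ht_pos ht_zero ht_div hx
      (hneg _ (by linarith [hu_pos l])) (hleft l) (half_pos (sub_pos.2 ha))] with k hk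
    linarith
  · obtain ⟨l, hl⟩ := (hu.eventually_lt_const (half_pos (sub_pos.2 ha))).exists
    filter_upwards [eventually_lt_of_sign_recursion ht_pos ht_zero ht_div hx
      (hpos _ (by linarith [hu_pos l])) (hright l) (half_pos (sub_pos.2 ha))] with k hk
    linarith

end Orbit

/-! ### Convergence of random series -/

/-- A series of independent centred square-integrable random variables with summable variances
converges almost surely. -/
lemma ProbabilityTheory.iIndepFun.ae_exists_tendsto_sum {Ω : Type*} [MeasurableSpace Ω]
    {P : Measure Ω} [IsProbabilityMeasure P] {Y : ℕ → Ω → ℝ} (hY : iIndepFun Y P)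
    (hmeas : ∀ k, Measurable (Y k)) (hL2 : ∀ k, MemLp (Y k) 2 P) (hmean : ∀ k, P[Y k] = 0)
    (hvar : Summable fun k => variance (Y k) P) :
    ∀ᵐ ω ∂P, ∃ c, Tendsto (fun N => ∑ k ∈ Finset.range N, Y k ω) atTop (nhds c) := by
  have hsm : ∀ k, StronglyMeasurable (Y k) := fun k => (hmeas k).stronglyMeasurable
  set S : ℕ → Ω → ℝ := fun N => ∑ k ∈ Finset.range (N + 1), Y k with hS
  have hSL2 : ∀ N, MemLp (S N) 2 P := fun N => memLp_finsetSum' _ fun k _ => hL2 k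
  have hint : ∀ k, Integrable (Y k) P := fun k => (hL2 k).integrable one_le_two
  have hmart : Martingale S (Filtration.natural Y hsm) P := by
    refine martingale_of_condExp_sub_eq_zero_nat (fun N => ?_)
      (fun N => (hSL2 N).integrable one_le_two) fun N => ?_
    · refine Finset.stronglyMeasurable_sum _ fun k hk => ?_
      exact (Filtration.stronglyAdapted_natural hsm k).mono
        ((Filtration.natural Y hsm).mono (by simpa [Nat.lt_succ_iff] using hk))
    · have : S (N + 1) - S N = Y (N + 1) := by
        simp [hS, Finset.sum_range_succ _ (N + 1)]
      rw [this]
      refine (hY.condExp_natural_ae_eq_of_lt hsm N.lt_succ_self).trans ?_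
      rw [hmean]
      rfl
  have hSmean : ∀ N, P[S N] = 0 := fun N => by
    simp only [hS, Finset.sum_apply]
    rw [integral_finsetSum _ fun k _ => hint k]
    exact Finset.sum_eq_zero fun k _ => hmean k
  have hSsq : ∀ N, ∫ ω, S N ω ^ 2 ∂P ≤ ∑' k, variance (Y k) P := fun N => by
    rw [← variance_of_integral_eq_zero (hSL2 N).aemeasurable (hSmean N), hS,
      IndepFun.variance_sum (fun k _ => hL2 k) fun i _ j _ hij => hY.indepFun hij]
    exact hvar.sum_le_tsum _ fun k _ => variance_nonneg _ _
  have hbdd : ∀ N, eLpNorm (S N) 1 P ≤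
      (Real.toNNReal (1 + ∑' k, variance (Y k) P) : ℝ≥0∞) := fun N => by
    rw [eLpNorm_one_eq_lintegral_enorm,
      ← ofReal_integral_norm_eq_lintegral_enorm ((hSL2 N).integrable one_le_two)]
    refine ENNReal.ofReal_le_ofReal ?_
    calc ∫ ω, ‖S N ω‖ ∂P ≤ ∫ ω, (1 + S N ω ^ 2) ∂P := by
          refine integral_mono ((hSL2 N).integrable one_le_two).norm
            ((integrable_const _).add (hSL2 N).integrable_sq) fun ω => ?_
          rw [Real.norm_eq_abs, ← sq_abs]
          nlinarith [sq_nonneg (|S N ω| - 1)]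
      _ = 1 + ∫ ω, S N ω ^ 2 ∂P := by
          rw [integral_add (integrable_const _) (hSL2 N).integrable_sq]
          simp
      _ ≤ _ := by linarith [hSsq N]
  filter_upwards [hmart.submartingale.exists_ae_tendsto_of_bdd hbdd] with ω hω
  obtain ⟨c, hc⟩ := hω
  refine ⟨c, (tendsto_add_atTop_iff_nat 1).1 ?_⟩
  simpa [hS] using hc

/-! ### The mean sign and the median of a probability measure -/

/-- The mean of `sgn (x - y)` for `y` distributed according to `ν`. -/
noncomputable def meanSign (ν : Measure ℝ) (x : ℝ) : ℝ := ∫ y, Real.sign (x - y) ∂ν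

section MeanSign

variable {ν : Measure ℝ} [IsProbabilityMeasure ν]

lemma integrable_sign_sub (x : ℝ) : Integrable (fun y => Real.sign (x - y)) ν :=
  Integrable.of_bound
    (Real.measurable_sign.comp (measurable_const.sub measurable_id)).aestronglyMeasurable 1
    (ae_of_all _ fun _ => Real.norm_sign_le_one _)

lemma meanSign_eq_one {x : ℝ} (h : ∀ᵐ y ∂ν, y < x) : meanSign ν x = 1 := by
  have : (fun y => Real.sign (x - y)) =ᵐ[ν] fun _ => 1 := by
    filter_upwards [h] with y hy using Real.sign_of_pos (sub_pos.2 hy)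
  rw [meanSign, integral_congr_ae this]
  simp

lemma meanSign_eq_neg_one {x : ℝ} (h : ∀ᵐ y ∂ν, x < y) : meanSign ν x = -1 := by
  have : (fun y => Real.sign (x - y)) =ᵐ[ν] fun _ => -1 := by
    filter_upwards [h] with y hy using Real.sign_of_neg (sub_neg.2 hy)
  rw [meanSign, integral_congr_ae this]
  simp

lemma continuous_meanSign [NullSingletonClass ν] : Continuous (meanSign ν) := by
  refine continuous_iff_continuousAt.2 fun x => ?_
  refine continuousAt_of_dominated (bound := fun _ => 1)
    (Eventually.of_forall fun z => (integrable_sign_sub z).aestronglyMeasurable)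
    (Eventually.of_forall fun z => ae_of_all _ fun _ => Real.norm_sign_le_one _)
    (integrable_const _) ?_
  filter_upwards [Measure.ae_ne ν x] with y hy
  exact (Real.continuousAt_sign (sub_ne_zero.2 hy.symm)).comp (f := fun z => z - y)
    (continuousAt_id.sub continuousAt_const)

lemma tendsto_meanSign_atTop : Tendsto (meanSign ν) atTop (nhds 1) := by
  have h : Tendsto (fun x => ∫ y, Real.sign (x - y) ∂ν) atTop (nhds (∫ _, (1 : ℝ) ∂ν)) := by
    refine tendsto_integral_filter_of_dominated_convergence (fun _ => 1)
      (Eventually.of_forall fun z => (integrable_sign_sub z).aestronglyMeasurable)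
      (Eventually.of_forall fun z => ae_of_all _ fun _ => Real.norm_sign_le_one _)
      (integrable_const _) (ae_of_all _ fun y => tendsto_const_nhds.congr' ?_)
    filter_upwards [eventually_gt_atTop y] with x hx using (Real.sign_of_pos (sub_pos.2 hx)).symm
  rw [integral_const, probReal_univ, one_smul] at h
  exact h

lemma tendsto_meanSign_atBot : Tendsto (meanSign ν) atBot (nhds (-1)) := by
  have h : Tendsto (fun x => ∫ y, Real.sign (x - y) ∂ν) atBot (nhds (∫ _, (-1 : ℝ) ∂ν)) := by
    refine tendsto_integral_filter_of_dominated_convergence (fun _ => 1)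
      (Eventually.of_forall fun z => (integrable_sign_sub z).aestronglyMeasurable)
      (Eventually.of_forall fun z => ae_of_all _ fun _ => Real.norm_sign_le_one _)
      (integrable_const _) (ae_of_all _ fun y => tendsto_const_nhds.congr' ?_)
    filter_upwards [eventually_lt_atBot y] with x hx using (Real.sign_of_neg (sub_neg.2 hx)).symm
  rw [integral_const, probReal_univ, one_smul] at h
  exact h

lemma exists_meanSign_eq_zero [NullSingletonClass ν] : ∃ m, meanSign ν m = 0 :=
  mem_range_of_exists_le_of_exists_ge continuous_meanSign
    ((tendsto_meanSign_atBot.eventually_lt_const (by norm_num)).exists.imp fun _ => le_of_lt)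
    ((tendsto_meanSign_atTop.eventually_const_lt (by norm_num)).exists.imp fun _ => le_of_lt)

/-- If the support of `ν` has no gaps, the mean sign is strictly increasing around its zeros. -/
lemma meanSign_lt_of_eq_zero [NullSingletonClass ν]
    (hgap : ∀ a b, a < b → ν (Set.Ioo a b) = 0 → ν (Set.Iic a) = 0 ∨ ν (Set.Ici b) = 0)
    {a b : ℝ} (hab : a < b) (hzero : meanSign ν a = 0 ∨ meanSign ν b = 0) :
    meanSign ν a < meanSign ν b := by
  have hIoo : ν (Set.Ioo a b) ≠ 0 := by
    intro h0
    have hIoo' : ∀ᵐ y ∂ν, y ∉ Set.Ioo a b := measure_eq_zero_iff_ae_notMem.1 h0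
    rcases hgap a b hab h0 with h | h
    · have hae : ∀ᵐ y ∂ν, b < y := by
        filter_upwards [hIoo', measure_eq_zero_iff_ae_notMem.1 h, Measure.ae_ne ν b]
          with y h1 h2 h3
        simp only [Set.mem_Ioo, Set.mem_Iic, not_and, not_lt, not_le] at h1 h2
        exact lt_of_le_of_ne (h1 h2) h3.symm
      have h1 := meanSign_eq_neg_one hae
      have h2 : meanSign ν a = -1 := meanSign_eq_neg_one (hae.mono fun y hy => hab.trans hy)
      rcases hzero with h | h <;> linarith
    · have hae : ∀ᵐ y ∂ν, y < a := by
        filter_upwards [hIoo', measure_eq_zero_iff_ae_notMem.1 h, Measure.ae_ne ν a]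
          with y h1 h2 h3
        simp only [Set.mem_Ioo, Set.mem_Ici, not_and, not_lt, not_le] at h1 h2
        exact lt_of_le_of_ne (not_lt.1 fun hy => (h1 hy).not_gt h2) h3
      have h1 := meanSign_eq_one hae
      have h2 : meanSign ν b = 1 := meanSign_eq_one (hae.mono fun y hy => hy.trans hab)
      rcases hzero with h | h <;> linarith
  rw [← sub_pos, meanSign, meanSign, ← integral_sub (integrable_sign_sub b) (integrable_sign_sub a),
    integral_pos_iff_support_of_nonneg
      (fun y => sub_nonneg.2 (Real.sign_monotone (sub_le_sub_right hab.le y)))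
      ((integrable_sign_sub b).sub (integrable_sign_sub a))]
  refine (pos_iff_ne_zero.2 hIoo).trans_le (measure_mono fun y hy => ?_)
  rw [Function.mem_support, Real.sign_of_pos (sub_pos.2 hy.2), Real.sign_of_neg (sub_neg.2 hy.1)]
  norm_num

lemma integral_abs_sub_add_le (hid : Integrable id ν) (c x : ℝ) :
    ∫ y, |c - y| ∂ν + meanSign ν c * (x - c) ≤ ∫ y, |x - y| ∂ν := by
  have habs : ∀ z : ℝ, Integrable (fun y => |z - y|) ν := fun z =>
    ((integrable_const z).sub hid).abs
  rw [meanSign, ← integral_mul_const, ← integral_add (habs c) ((integrable_sign_sub c).mul_const _)]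
  exact integral_mono ((habs c).add ((integrable_sign_sub c).mul_const _)) (habs x)
    fun y => Real.abs_add_sign_mul_le c x y

lemma integral_abs_sub_lt_of_ne_median (hid : Integrable id ν) {m : ℝ} (hm : meanSign ν m = 0)
    (hpos : ∀ q, m < q → 0 < meanSign ν q) (hneg : ∀ q, q < m → meanSign ν q < 0)
    {x : ℝ} (hx : x ≠ m) : ∫ y, |m - y| ∂ν < ∫ y, |x - y| ∂ν := by
  have h1 := integral_abs_sub_add_le hid m ((m + x) / 2)
  have h2 := integral_abs_sub_add_le hid ((m + x) / 2) x
  have h3 : 0 < meanSign ν ((m + x) / 2) * (x - (m + x) / 2) := by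
    rcases lt_or_gt_of_ne hx with h | h
    · exact mul_pos_of_neg_of_neg (hneg _ (by linarith)) (by linarith)
    · exact mul_pos (hpos _ (by linarith)) (by linarith)
  rw [hm, zero_mul] at h1
  linarith

/-- Almost surely, weighted signs seen from a fixed point average out to the mean sign. -/
lemma ae_cauchySeq_sum_sign {Ω : Type*} [MeasurableSpace Ω] {P : Measure Ω}
    [IsProbabilityMeasure P] {p : ℕ → Ω → ℝ} (hp : ∀ k, Measurable (p k)) (hindep : iIndepFun p P)
    (hlaw : ∀ k, Measure.map (p k) P = ν) {t : ℕ → ℝ} (ht_sq : Summable fun k => t k ^ 2) (q : ℝ) :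
    ∀ᵐ ω ∂P, CauchySeq fun N =>
      ∑ k ∈ Finset.range N, t k * (Real.sign (q - p k ω) - meanSign ν q) := by
  set h : ℕ → ℝ → ℝ := fun k y => t k * (Real.sign (q - y) - meanSign ν q)
  have hh : ∀ k, Measurable (h k) := fun k =>
    ((Real.measurable_sign.comp (measurable_const.sub measurable_id)).sub_const _).const_mul _
  have hmeas : ∀ k, Measurable (h k ∘ p k) := fun k => (hh k).comp (hp k)
  have hmS : |meanSign ν q| ≤ 1 := by
    have := norm_integral_le_of_norm_le_const (μ := ν)
      (ae_of_all _ fun y => Real.norm_sign_le_one (q - y))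
    simpa [meanSign] using this
  have hbound : ∀ k y, |h k y| ≤ |t k| * 2 := fun k y => by
    rw [abs_mul]
    refine mul_le_mul_of_nonneg_left ((abs_sub _ _).trans ?_) (abs_nonneg _)
    linarith [Real.norm_sign_le_one (q - y), Real.norm_eq_abs (Real.sign (q - y))]
  have hL2 : ∀ k, MemLp (h k ∘ p k) 2 P := fun k =>
    MemLp.of_bound (hmeas k).aestronglyMeasurable (|t k| * 2) (ae_of_all _ fun ω => hbound k _)
  have hmean : ∀ k, P[h k ∘ p k] = 0 := fun k => by
    have h1 : ∫ ω, h k (p k ω) ∂P = ∫ y, h k y ∂ν := by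
      rw [← hlaw k, integral_map (hp k).aemeasurable (hh k).aestronglyMeasurable]
    simp only [Function.comp]
    rw [h1, integral_const_mul, integral_sub (integrable_sign_sub q) (integrable_const _)]
    simp [meanSign]
  have hvar : Summable fun k => variance (h k ∘ p k) P := by
    refine Summable.of_nonneg_of_le (fun k => variance_nonneg _ _) (fun k => ?_)
      (ht_sq.mul_left 4)
    rw [variance_of_integral_eq_zero (hmeas k).aemeasurable (hmean k)]
    calc ∫ ω, (h k ∘ p k) ω ^ 2 ∂P ≤ ∫ _, 4 * t k ^ 2 ∂P := by
          refine integral_mono (hL2 k).integrable_sq (integrable_const _) fun ω => ?_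
          have := pow_le_pow_left₀ (abs_nonneg _) (hbound k (p k ω)) 2
          rw [sq_abs, mul_pow (|t k|), sq_abs] at this
          simp only [Function.comp]
          linarith
      _ = 4 * t k ^ 2 := by simp
  filter_upwards [(hindep.comp h hh).ae_exists_tendsto_sum hmeas hL2 hmean hvar] with ω hω
  exact hω.choose_spec.cauchySeq

end MeanSign

/-! ### Coordinate marginals of a connected body -/

section Marginal

variable {n : ℕ} {K : Set (Fin n → ℝ)}

lemma nullSingletonClass_map_eval (i : Fin n) :
    NullSingletonClass ((volume.restrict K).map fun y : Fin n → ℝ => y i) := by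
  refine ⟨fun c => ?_⟩
  rw [Measure.map_apply (measurable_pi_apply i) (measurableSet_singleton c)]
  exact Measure.absolutelyContinuous_of_le Measure.restrict_le_self
    (Measure.pi_hyperplane (fun _ : Fin n => (volume : Measure ℝ)) i c)

lemma map_eval_Iic_eq_zero_or_Ici_eq_zero (hKconn : IsConnected K)
    (hKbody : K = closure (interior K)) (i : Fin n) {a b : ℝ} (hab : a < b)
    (h : (volume.restrict K).map (fun y : Fin n → ℝ => y i) (Set.Ioo a b) = 0) :
    (volume.restrict K).map (fun y : Fin n → ℝ => y i) (Set.Iic a) = 0 ∨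
      (volume.restrict K).map (fun y : Fin n → ℝ => y i) (Set.Ici b) = 0 := by
  have hKmeas : MeasurableSet K := by
    rw [hKbody]
    exact isClosed_closure.measurableSet
  have hei : Measurable fun y : Fin n → ℝ => y i := measurable_pi_apply i
  have hopen : IsOpen ((fun y : Fin n → ℝ => y i) ⁻¹' Set.Ioo a b) :=
    isOpen_Ioo.preimage (continuous_apply i)
  rw [Measure.map_apply hei measurableSet_Ioo,
    Measure.restrict_apply (hei measurableSet_Ioo)] at h
  have hdisj : ∀ y ∈ K, y i ∉ Set.Ioo a b := by
    intro y hy hyi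
    rw [hKbody] at hy
    obtain ⟨z, hz⟩ := mem_closure_iff.1 hy _ hopen hyi
    refine (hopen.inter isOpen_interior).measure_ne_zero volume ⟨z, hz⟩ ?_
    exact measure_mono_null (Set.inter_subset_inter_right _ interior_subset) h
  have hconv : Set.OrdConnected ((fun y : Fin n → ℝ => y i) '' K) :=
    (hKconn.isPreconnected.image _ (continuous_apply i).continuousOn).ordConnected
  rw [Measure.map_apply hei measurableSet_Iic, Measure.map_apply hei measurableSet_Ici,
    Measure.restrict_apply (hei measurableSet_Iic), Measure.restrict_apply (hei measurableSet_Ici)]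
  by_contra! hcon
  obtain ⟨y, hya, hy⟩ := nonempty_of_measure_ne_zero hcon.1
  obtain ⟨z, hzb, hz⟩ := nonempty_of_measure_ne_zero hcon.2
  obtain ⟨c, hc⟩ := exists_between hab
  obtain ⟨w, hw, rfl⟩ := hconv.out ⟨y, hy, rfl⟩ ⟨z, hz, rfl⟩
    ⟨le_trans hya hc.1.le, le_trans hc.2.le hzb⟩
  exact hdisj w hw hc

lemma integrable_id_map_eval (hK : IsCompact K) (i : Fin n) :
    Integrable id ((volume.restrict K).map fun y : Fin n → ℝ => y i) := by
  have hei : Measurable fun y : Fin n → ℝ => y i := measurable_pi_apply i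
  rw [integrable_map_measure aestronglyMeasurable_id hei.aemeasurable]
  exact (continuous_apply i).continuousOn.integrableOn_compact hK

end Marginal

/-- Let `K ⊆ ℝⁿ` be a connected compact body (a nonempty compact set
equal to the closure of its interior) of Lebesgue measure one, and let
`f_K x = ∫_K d₁ x y dy` with `d₁ x y = ∑ i, |x i - y i|`. Let `(P_k)` be a sequence of
independent random variables, each uniformly distributed on `K` (here `P k` stands for
`P_{k+1}` and `t k` for `t_{k+1}`), let `X 0 ∈ K`, and define recursively
`X_{k+1} = X_k - t_{k+1} • Q_{k+1}` where `Q_{k+1} i = sgn (X_k i - P_{k+1} i)`, the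
positive reals `t_k` decreasing with `∑ t_k = ∞` and `∑ t_k² < ∞`. Then `f_K` has a
unique global minimizer `x*` and `X_k → x*` almost surely. -/
theorem stochastic_gradient_descent_converges_to_unique_minimizer
    (n : ℕ) (K : Set (Fin n → ℝ)) (hK : IsCompact K) (hKconn : IsConnected K)
    (hKbody : K = closure (interior K)) (hKvol : volume K = 1)
    (f : (Fin n → ℝ) → ℝ)
    (hf : ∀ x, f x = ∫ y in K, ∑ i, |x i - y i|)
    (Ω : Type) [MeasurableSpace Ω] (P : Measure Ω) [IsProbabilityMeasure P]
    (Pseq : ℕ → Ω → (Fin n → ℝ))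
    (hPmeas : ∀ k, Measurable (Pseq k))
    (hPindep : iIndepFun Pseq P)
    (hPlaw : ∀ k, Measure.map (Pseq k) P = volume.restrict K)
    (t : ℕ → ℝ) (ht_pos : ∀ k, 0 < t k) (ht_anti : Antitone t)
    (ht_div : Tendsto (fun N => ∑ k ∈ Finset.range N, t k) atTop atTop)
    (ht_sq : Summable fun k => t k ^ 2)
    (X : ℕ → Ω → (Fin n → ℝ))
    (hX0 : ∀ ω, X 0 ω ∈ K)
    (hXrec : ∀ k ω,
      X (k + 1) ω = X k ω - t k • fun i => Real.sign (X k ω i - Pseq k ω i)) :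
    ∃ xstar : Fin n → ℝ,
      (∀ z, f xstar ≤ f z) ∧
      (∀ w, (∀ z, f w ≤ f z) → w = xstar) ∧
      ∀ᵐ ω ∂P, Tendsto (fun k => X k ω) atTop (nhds xstar) := by
  have hprob : IsProbabilityMeasure (volume.restrict K) := ⟨by simpa using hKvol⟩
  have ht_zero : Tendsto t atTop (nhds 0) := by
    have h := ht_sq.tendsto_atTop_zero.sqrt
    simpa [Real.sqrt_sq (ht_pos _).le] using h
  have hei : ∀ i, Measurable fun y : Fin n → ℝ => y i := fun i => measurable_pi_apply i
  set ν : Fin n → Measure ℝ := fun i => (volume.restrict K).map fun y => y i with hν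
  have hνprob : ∀ i, IsProbabilityMeasure (ν i) := fun i =>
    Measure.isProbabilityMeasure_map (hei i).aemeasurable
  have hνatoms : ∀ i, NullSingletonClass (ν i) := fun i => nullSingletonClass_map_eval i
  have hνid : ∀ i, Integrable id (ν i) := fun i => integrable_id_map_eval hK i
  choose m hm using fun i => exists_meanSign_eq_zero (ν := ν i)
  have hgap : ∀ i a b, a < b → ν i (Set.Ioo a b) = 0 →
      ν i (Set.Iic a) = 0 ∨ ν i (Set.Ici b) = 0 := fun i a b hab =>
    map_eval_Iic_eq_zero_or_Ici_eq_zero hKconn hKbody i hab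
  have hpos : ∀ i q, m i < q → 0 < meanSign (ν i) q := fun i q hq =>
    hm i ▸ meanSign_lt_of_eq_zero (hgap i) hq (Or.inl (hm i))
  have hneg : ∀ i q, q < m i → meanSign (ν i) q < 0 := fun i q hq =>
    hm i ▸ meanSign_lt_of_eq_zero (hgap i) hq (Or.inr (hm i))
  have hlt : ∀ i x, x ≠ m i → ∫ y, |m i - y| ∂ν i < ∫ y, |x - y| ∂ν i := fun i x hx =>
    integral_abs_sub_lt_of_ne_median (hνid i) (hm i) (hpos i) (hneg i) hx
  have hle : ∀ i x, ∫ y, |m i - y| ∂ν i ≤ ∫ y, |x - y| ∂ν i := fun i x => by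
    rcases eq_or_ne x (m i) with rfl | hx
    · exact le_rfl
    · exact (hlt i x hx).le
  have hfsum : ∀ x, f x = ∑ i, ∫ y, |x i - y| ∂ν i := fun x => by
    rw [hf, integral_finsetSum]
    · refine Finset.sum_congr rfl fun i _ => ?_
      exact (integral_map (hei i).aemeasurable
        (continuous_const.sub continuous_id).abs.aestronglyMeasurable).symm
    · exact fun i _ =>
        (continuous_const.sub (continuous_apply i)).abs.continuousOn.integrableOn_compact hK
  refine ⟨m, fun z => ?_, fun w hw => ?_, ?_⟩
  · rw [hfsum, hfsum]
    exact Finset.sum_le_sum fun i _ => hle i (z i)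
  · by_contra hne
    obtain ⟨i, hi⟩ := Function.ne_iff.1 hne
    refine (hw m).not_gt ?_
    rw [hfsum, hfsum]
    exact Finset.sum_lt_sum (fun j _ => hle j (w j)) ⟨i, Finset.mem_univ i, hlt i _ hi⟩
  · have hcauchy : ∀ i q, ∀ᵐ ω ∂P, CauchySeq fun N =>
        ∑ k ∈ Finset.range N, t k * (Real.sign (q - Pseq k ω i) - meanSign (ν i) q) :=
      fun i q => ae_cauchySeq_sum_sign (p := fun k ω => Pseq k ω i)
        (fun k => (hei i).comp (hPmeas k)) (hPindep.comp (fun _ y => y i) fun _ => hei i)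
        (fun k => by
          simp only [hν, ← hPlaw k]
          exact (Measure.map_map (hei i) (hPmeas k)).symm) ht_sq q
    have hright := ae_all_iff.2 fun i => ae_all_iff.2 fun l : ℕ =>
      hcauchy i (m i + 1 / ((l : ℝ) + 1))
    have hleft := ae_all_iff.2 fun i => ae_all_iff.2 fun l : ℕ =>
      hcauchy i (m i - 1 / ((l : ℝ) + 1))
    filter_upwards [hright, hleft] with ω h1 h2
    refine tendsto_pi_nhds.2 fun i => ?_
    exact tendsto_of_sign_recursion (p := fun k => Pseq k ω i) (g := meanSign (ν i))
      ht_pos ht_zero ht_div (fun k => by simp [hXrec k ω]) (fun l => Nat.one_div_pos_of_nat)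
      tendsto_one_div_add_atTop_nhds_zero_nat (hpos i) (hneg i) (h1 i) (h2 i)
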